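/- For all n ≥ k ≥ 1, every sequence of CTRs α₁ ≥ … ≥ α_k ≥ 0, and every ρ > 1, there exists a universally truthful randomized mechanism (a finite probability space (Ω, μ) with a deterministic truthful mechanism M_ω for each ω) such that for every true profile (v, γ) ∈ (0,∞)ⁿ × [0,∞)ⁿ satisfying the large-market assumption v_i·α₁ < OPT(v)/ρ for every bidder i, the expected social welfare at the truthful report, Σ_ω μ(ω)·Σ_i v_i·α_{π_ω(v,γ)(i)}, is at least ((1 − 1/ρ)/48)·OPT(v). (Theorem 4: the large-market auction is truthful with expected approximation ratio at most 48/(1 − 1/ρ).) -/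

import Mathlib

open Finset

/-- CTR of slot `j` among `k` real slots; slot index `k` is the dummy slot with CTR `0`. -/
noncomputable def ctr (k : ℕ) (α : Fin k → ℝ) (j : Fin (k + 1)) : ℝ :=
  if h : (j : ℕ) < k then α ⟨j, h⟩ else 0

/-- A feasible assignment: each non-dummy slot is assigned to at most one bidder. -/
def Feasible (n k : ℕ) (π : Fin n → Fin (k + 1)) : Prop :=
  ∀ i j : Fin n, π i = π j → (π i : ℕ) < k → i = j

/-- Social welfare of the assignment `π` under values `v`. -/
noncomputable def welfare (n k : ℕ) (α : Fin k → ℝ) (v : Fin n → ℝ)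
    (π : Fin n → Fin (k + 1)) : ℝ :=
  ∑ i, v i * ctr k α (π i)

/-- Optimal social welfare. -/
noncomputable def OPT (n k : ℕ) (α : Fin k → ℝ) (v : Fin n → ℝ) : ℝ :=
  sSup {w : ℝ | ∃ π : Fin n → Fin (k + 1), Feasible n k π ∧ w = welfare n k α v π}

/-- Truthfulness of a deterministic mechanism `(asg, pay)` in the private allowance setting. -/
def TruthfulPriv (n k : ℕ) (α : Fin k → ℝ)
    (asg : (Fin n → ℝ) → (Fin n → ℝ) → Fin n → Fin (k + 1))
    (pay : (Fin n → ℝ) → (Fin n → ℝ) → Fin n → ℝ) : Prop :=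
  ∀ v γ : Fin n → ℝ, (∀ j, 0 < v j) → (∀ j, 0 ≤ γ j) → ∀ i : Fin n,
    pay v γ i ≤ v i * ctr k α (asg v γ i) ∧
    ∀ b' g' : ℝ, 0 < b' → 0 ≤ g' →
      (pay (Function.update v i b') (Function.update γ i g') i ≤
        v i * ctr k α (asg (Function.update v i b') (Function.update γ i g') i)) →
      v i * ctr k α (asg v γ i) - max 0 (pay v γ i - γ i) ≥
        v i * ctr k α (asg (Function.update v i b') (Function.update γ i g') i)
          - max 0 (pay (Function.update v i b') (Function.update γ i g') i - γ i)

/-! ### Sequential posted prices -/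

/-- Quasi-linear payoff above the allowance `γ`. -/
noncomputable def payoff (x γ c p : ℝ) : ℝ := x * c - max 0 (p - γ)

/-- `j` is an affordable slot of the menu `A` maximizing the payoff at slot prices `P`. -/
def IsBest {k : ℕ} (α : Fin k → ℝ) (P : Fin (k + 1) → ℝ) (x γ : ℝ)
    (A : Finset (Fin (k + 1))) (j : Fin (k + 1)) : Prop :=
  j ∈ A ∧ P j ≤ x * ctr k α j ∧
    ∀ j' ∈ A, P j' ≤ x * ctr k α j' → payoff x γ (ctr k α j') (P j') ≤ payoff x γ (ctr k α j) (P j)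

theorem ctr_last {k : ℕ} (α : Fin k → ℝ) : ctr k α (Fin.last k) = 0 := by
  simp [ctr]

theorem exists_isBest {k : ℕ} (α : Fin k → ℝ) {P : Fin (k + 1) → ℝ} (hP : P (Fin.last k) = 0)
    (x γ : ℝ) {A : Finset (Fin (k + 1))} (hA : Fin.last k ∈ A) : ∃ j, IsBest α P x γ A j := by
  obtain ⟨j, hj, hmax⟩ := Finset.exists_max_image (A.filter fun j => P j ≤ x * ctr k α j)
    (fun j => payoff x γ (ctr k α j) (P j))
    ⟨Fin.last k, by simp [hA, hP, ctr_last]⟩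
  rw [Finset.mem_filter] at hj
  exact ⟨j, hj.1, hj.2, fun j' h1 h2 => hmax j' (Finset.mem_filter.2 ⟨h1, h2⟩)⟩

open Classical in
/-- A payoff-maximizing affordable slot of the menu `A`. -/
noncomputable def pick {k : ℕ} (α : Fin k → ℝ) (P : Fin (k + 1) → ℝ) (x γ : ℝ)
    (A : Finset (Fin (k + 1))) : Fin (k + 1) :=
  if h : ∃ j, IsBest α P x γ A j then h.choose else Fin.last k

theorem isBest_pick {k : ℕ} (α : Fin k → ℝ) {P : Fin (k + 1) → ℝ} (hP : P (Fin.last k) = 0)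
    (x γ : ℝ) {A : Finset (Fin (k + 1))} (hA : Fin.last k ∈ A) :
    IsBest α P x γ A (pick α P x γ A) := by
  have h := exists_isBest α hP x γ hA
  rw [pick, dif_pos h]
  exact h.choose_spec

/-- The slots offered to bidder `i` when `S` is the sample and the slots `U` are taken. -/
def menu {n k : ℕ} (S : Finset (Fin n)) (i : Fin n) (U : Finset (Fin (k + 1))) :
    Finset (Fin (k + 1)) :=
  if i ∈ S then {Fin.last k} else Finset.univ.filter fun j => j = Fin.last k ∨ j ∉ U

theorem last_mem_menu {n k : ℕ} (S : Finset (Fin n)) (i : Fin n) (U : Finset (Fin (k + 1))) :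
    Fin.last k ∈ menu S i U := by
  unfold menu
  split_ifs <;> simp

/-- Slots taken by the first `t` bidders. -/
noncomputable def taken {n k : ℕ} (α : Fin k → ℝ) (P : Fin (k + 1) → ℝ) (S : Finset (Fin n))
    (v γ : Fin n → ℝ) : ℕ → Finset (Fin (k + 1))
  | 0 => ∅
  | t + 1 =>
    if h : t < n then
      insert (pick α P (v ⟨t, h⟩) (γ ⟨t, h⟩) (menu S ⟨t, h⟩ (taken α P S v γ t)))
        (taken α P S v γ t)
    else taken α P S v γ t

/-- The slot bought by bidder `i` under sequential posted prices `P`. -/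
noncomputable def bought {n k : ℕ} (α : Fin k → ℝ) (P : Fin (k + 1) → ℝ) (S : Finset (Fin n))
    (v γ : Fin n → ℝ) (i : Fin n) : Fin (k + 1) :=
  pick α P (v i) (γ i) (menu S i (taken α P S v γ i))

theorem taken_congr {n k : ℕ} (α : Fin k → ℝ) (P : Fin (k + 1) → ℝ) (S : Finset (Fin n))
    {v γ v' γ' : Fin n → ℝ} (t : ℕ) (hv : ∀ i : Fin n, (i : ℕ) < t → v i = v' i)
    (hγ : ∀ i : Fin n, (i : ℕ) < t → γ i = γ' i) :
    taken α P S v γ t = taken α P S v' γ' t := by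
  induction t with
  | zero => rfl
  | succ t ih =>
    have ih' := ih (fun i hi => hv i (by omega)) (fun i hi => hγ i (by omega))
    simp only [taken]
    split_ifs with h
    · rw [ih', hv ⟨t, h⟩ (by simp), hγ ⟨t, h⟩ (by simp)]
    · exact ih'

theorem taken_mono {n k : ℕ} (α : Fin k → ℝ) (P : Fin (k + 1) → ℝ) (S : Finset (Fin n))
    (v γ : Fin n → ℝ) : Monotone (taken α P S v γ) := by
  refine monotone_nat_of_le_succ fun t => ?_
  simp only [taken]
  split_ifs
  · exact Finset.subset_insert _ _
  · exact le_rfl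

theorem bought_mem_taken {n k : ℕ} (α : Fin k → ℝ) (P : Fin (k + 1) → ℝ) (S : Finset (Fin n))
    (v γ : Fin n → ℝ) {i : Fin n} {t : ℕ} (h : (i : ℕ) < t) :
    bought α P S v γ i ∈ taken α P S v γ t := by
  refine taken_mono α P S v γ (Nat.succ_le_of_lt h) ?_
  simp [taken, bought]

theorem mem_taken {n k : ℕ} (α : Fin k → ℝ) (P : Fin (k + 1) → ℝ) (S : Finset (Fin n))
    (v γ : Fin n → ℝ) {t : ℕ} {j : Fin (k + 1)} (h : j ∈ taken α P S v γ t) :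
    ∃ i, bought α P S v γ i = j := by
  induction t with
  | zero => simp [taken] at h
  | succ t ih =>
    simp only [taken] at h
    split_ifs at h with ht
    · rcases Finset.mem_insert.1 h with h | h
      · exact ⟨⟨t, ht⟩, h.symm⟩
      · exact ih h
    · exact ih h

theorem isBest_bought {n k : ℕ} (α : Fin k → ℝ) {P : Fin (k + 1) → ℝ} (hP : P (Fin.last k) = 0)
    (S : Finset (Fin n)) (v γ : Fin n → ℝ) (i : Fin n) :
    IsBest α P (v i) (γ i) (menu S i (taken α P S v γ i)) (bought α P S v γ i) :=
  isBest_pick α hP _ _ (last_mem_menu _ _ _)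

theorem bought_of_mem {n k : ℕ} (α : Fin k → ℝ) {P : Fin (k + 1) → ℝ} (hP : P (Fin.last k) = 0)
    {S : Finset (Fin n)} (v γ : Fin n → ℝ) {i : Fin n} (hi : i ∈ S) :
    bought α P S v γ i = Fin.last k := by
  have h := (isBest_bought α hP S v γ i).1
  simpa [menu, hi] using h

theorem feasible_bought {n k : ℕ} (α : Fin k → ℝ) {P : Fin (k + 1) → ℝ}
    (hP : P (Fin.last k) = 0) (S : Finset (Fin n)) (v γ : Fin n → ℝ) :
    Feasible n k (bought α P S v γ) := by
  have key : ∀ i j : Fin n, i < j → bought α P S v γ i = bought α P S v γ j →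
      bought α P S v γ j = Fin.last k := by
    intro i j hij h
    have hm := (isBest_bought α hP S v γ j).1
    have ht : bought α P S v γ j ∈ taken α P S v γ j := h ▸ bought_mem_taken α P S v γ hij
    by_cases hj : j ∈ S
    · exact bought_of_mem α hP v γ hj
    · simp only [menu, hj, if_false, Finset.mem_filter, Finset.mem_univ, true_and] at hm
      exact hm.resolve_right (not_not.2 ht)
  intro i j h hlt
  rcases lt_trichotomy i j with hij | hij | hij
  · rw [h, key i j hij h] at hlt
    simp at hlt
  · exact hij
  · rw [key j i hij h.symm] at hlt
    simp at hlt

/-- If each slot `j ∈ J` has a designated buyer `τ j` outside the sample for whom both the price and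
the surplus of `j` are at least `x j`, then posted prices achieve half of `∑ x`. -/
theorem sum_le_two_mul_welfare {n k : ℕ} (α : Fin k → ℝ) {P : Fin (k + 1) → ℝ}
    (hP : P (Fin.last k) = 0) (hP0 : ∀ j, 0 ≤ P j) (S : Finset (Fin n)) {v γ : Fin n → ℝ}
    (hγ : ∀ i, 0 ≤ γ i) (J : Finset (Fin (k + 1))) (τ : Fin (k + 1) → Fin n)
    (hτ : Set.InjOn τ J) (hτS : ∀ j ∈ J, τ j ∉ S) (x : Fin (k + 1) → ℝ)
    (hxP : ∀ j ∈ J, x j ≤ P j) (hxv : ∀ j ∈ J, x j ≤ v (τ j) * ctr k α j - P j) :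
    ∑ j ∈ J, x j ≤ 2 * welfare n k α v (bought α P S v γ) := by
  classical
  set π := bought α P S v γ with hπ
  set u : Fin n → ℝ := fun i => payoff (v i) (γ i) (ctr k α (π i)) (P (π i)) with hu
  have hbest := isBest_bought α hP S v γ
  have hu0 : ∀ i, 0 ≤ u i := by
    intro i
    have h := (hbest i).2.2 (Fin.last k) (last_mem_menu _ _ _) (by simp [hP, ctr_last])
    have h0 : payoff (v i) (γ i) (ctr k α (Fin.last k)) (P (Fin.last k)) = 0 := by
      simp [payoff, ctr_last, hP, hγ i]
    rw [h0] at h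
    exact h
  have huv : ∀ i, u i ≤ v i * ctr k α (π i) := by
    intro i
    simp only [hu, payoff]
    linarith [le_max_left 0 (P (π i) - γ i)]
  have hrev : ∀ i, P (π i) ≤ v i * ctr k α (π i) := fun i => (hbest i).2.1
  set sold : Finset (Fin (k + 1)) := Finset.univ.image π with hsold
  have hj : ∀ j ∈ J, x j ≤ (if j ∈ sold then P j else 0) + u (τ j) := by
    intro j hjJ
    by_cases hs : j ∈ sold
    · rw [if_pos hs]
      linarith [hxP j hjJ, hu0 (τ j)]
    · rw [if_neg hs, zero_add]
      by_cases ha : P j ≤ v (τ j) * ctr k α j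
      · have hmem : j ∈ menu S (τ j) (taken α P S v γ (τ j)) := by
          simp only [menu, hτS j hjJ, if_false, Finset.mem_filter, Finset.mem_univ, true_and]
          right
          intro ht
          obtain ⟨i, hi⟩ := mem_taken α P S v γ ht
          exact hs (Finset.mem_image.2 ⟨i, Finset.mem_univ _, hi⟩)
        have h := (hbest (τ j)).2.2 j hmem ha
        refine le_trans (hxv j hjJ) (le_trans ?_ h)
        simp only [payoff]
        have : max 0 (P j - γ (τ j)) ≤ P j := max_le (hP0 j) (by linarith [hγ (τ j)])
        linarith
      · linarith [hxv j hjJ, hu0 (τ j)]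
  have h1 : ∑ j ∈ J, (if j ∈ sold then P j else 0) ≤ welfare n k α v π := by
    calc ∑ j ∈ J, (if j ∈ sold then P j else 0)
        ≤ ∑ j, (if j ∈ sold then P j else 0) :=
          Finset.sum_le_sum_of_subset_of_nonneg (Finset.subset_univ _) fun j _ _ => by
            split_ifs
            · exact hP0 j
            · exact le_rfl
      _ = ∑ j ∈ sold, P j := by simp
      _ ≤ ∑ i, P (π i) := Finset.sum_image_le_of_nonneg (fun i _ => hP0 _)
      _ ≤ welfare n k α v π := Finset.sum_le_sum fun i _ => hrev i
  have h2 : ∑ j ∈ J, u (τ j) ≤ welfare n k α v π := by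
    calc ∑ j ∈ J, u (τ j) = ∑ i ∈ J.image τ, u i := (Finset.sum_image hτ).symm
      _ ≤ ∑ i, u i :=
          Finset.sum_le_sum_of_subset_of_nonneg (Finset.subset_univ _) fun i _ _ => hu0 i
      _ ≤ welfare n k α v π := Finset.sum_le_sum fun i _ => huv i
  calc ∑ j ∈ J, x j ≤ ∑ j ∈ J, ((if j ∈ sold then P j else 0) + u (τ j)) := Finset.sum_le_sum hj
    _ ≤ 2 * welfare n k α v π := by
      rw [Finset.sum_add_distrib]
      linarith

/-! ### Order statistics -/

/-- Enumeration of `S` by decreasing value. -/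
noncomputable def ranked {n : ℕ} (v : Fin n → ℝ) (S : Finset (Fin n)) (a : Fin S.card) : Fin n :=
  S.equivFin.symm (Tuple.sort (fun b => -v (S.equivFin.symm b)) a)

/-- The `j`-th largest value (counting from `0`) in `S`, or `0` if there is none. -/
noncomputable def kthValue {n : ℕ} (v : Fin n → ℝ) (S : Finset (Fin n)) (j : ℕ) : ℝ :=
  if h : j < S.card then v (ranked v S ⟨j, h⟩) else 0

theorem ranked_mem {n : ℕ} (v : Fin n → ℝ) (S : Finset (Fin n)) (a : Fin S.card) :
    ranked v S a ∈ S := Subtype.property _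

theorem ranked_injective {n : ℕ} (v : Fin n → ℝ) (S : Finset (Fin n)) :
    Function.Injective (ranked v S) :=
  Subtype.val_injective.comp (S.equivFin.symm.injective.comp (Equiv.injective _))

theorem exists_ranked_eq {n : ℕ} (v : Fin n → ℝ) {S : Finset (Fin n)} {i : Fin n} (hi : i ∈ S) :
    ∃ a, ranked v S a = i :=
  ⟨(Tuple.sort (fun b => -v (S.equivFin.symm b))).symm (S.equivFin ⟨i, hi⟩), by simp [ranked]⟩

theorem ranked_antitone {n : ℕ} (v : Fin n → ℝ) (S : Finset (Fin n)) :
    Antitone fun a => v (ranked v S a) := by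
  intro a b hab
  have := Tuple.monotone_sort (fun b => -v (S.equivFin.symm b)) hab
  simpa [ranked] using this

theorem kthValue_congr {n : ℕ} {v v' : Fin n → ℝ} {S : Finset (Fin n)}
    (h : ∀ i ∈ S, v i = v' i) (j : ℕ) : kthValue v S j = kthValue v' S j := by
  have hf : (fun b => -v (S.equivFin.symm b)) = fun b => -v' (S.equivFin.symm b) := by
    funext b
    rw [h _ (Subtype.property _)]
  have hr : ranked v S = ranked v' S := by
    funext a
    simp only [ranked, hf]
  simp only [kthValue, hr]
  split_ifs with hj
  · exact h _ (ranked_mem _ _ _)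
  · rfl

theorem kthValue_nonneg {n : ℕ} {v : Fin n → ℝ} (hv : ∀ i, 0 < v i) (S : Finset (Fin n)) (j : ℕ) :
    0 ≤ kthValue v S j := by
  unfold kthValue
  split_ifs
  · exact (hv _).le
  · exact le_rfl

theorem le_kthValue {n : ℕ} (v : Fin n → ℝ) (S : Finset (Fin n)) {j : ℕ} {x : ℝ}
    (h : j < (S.filter fun i => x ≤ v i).card) : x ≤ kthValue v S j := by
  have hj : j < S.card := h.trans_le (Finset.card_filter_le _ _)
  rw [kthValue, dif_pos hj]
  by_contra! hlt
  have hsub : (S.filter fun i => x ≤ v i) ⊆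
      (Finset.univ.filter fun a : Fin S.card => a < ⟨j, hj⟩).image (ranked v S) := by
    intro i hi
    rw [Finset.mem_filter] at hi
    obtain ⟨a, rfl⟩ := exists_ranked_eq v hi.1
    refine Finset.mem_image_of_mem _ (Finset.mem_filter.2 ⟨Finset.mem_univ _, ?_⟩)
    by_contra! ha
    have := ranked_antitone v S ha
    simp only at this
    linarith [hi.2]
  have hcard := (Finset.card_le_card hsub).trans Finset.card_image_le
  have : (Finset.univ.filter fun a : Fin S.card => a < ⟨j, hj⟩).card = j := by
    rw [Finset.filter_gt_eq_Iio, Fin.card_Iio]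
  omega

/-! ### The random sampling mechanism -/

/-- Half of the welfare contribution of slot `j` in an optimal assignment within the sample. -/
noncomputable def samplePrice {n k : ℕ} (α : Fin k → ℝ) (S : Finset (Fin n)) (v : Fin n → ℝ)
    (j : Fin (k + 1)) : ℝ :=
  ctr k α j * kthValue v S j / 2

theorem samplePrice_last {n k : ℕ} (α : Fin k → ℝ) (S : Finset (Fin n)) (v : Fin n → ℝ) :
    samplePrice α S v (Fin.last k) = 0 := by
  simp [samplePrice, ctr_last]

/-- The assignment selling to the bidders outside `S` at the prices learnt from `S`. -/
noncomputable def sampleAssign {n k : ℕ} (α : Fin k → ℝ) (S : Finset (Fin n)) (v γ : Fin n → ℝ) :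
    Fin n → Fin (k + 1) :=
  bought α (samplePrice α S v) S v γ

theorem truthfulPriv_sampleAssign {n k : ℕ} (α : Fin k → ℝ) (S : Finset (Fin n)) :
    TruthfulPriv n k α (sampleAssign α S)
      (fun v γ i => samplePrice α S v (sampleAssign α S v γ i)) := by
  intro v γ _ hγ i
  have hbest := isBest_bought α (samplePrice_last α S v) S v γ i
  refine ⟨hbest.2.1, ?_⟩
  intro b' g' _ _ haff
  by_cases hi : i ∈ S
  · simp [sampleAssign, bought_of_mem α (samplePrice_last α S _) _ _ hi, samplePrice_last,
      ctr_last, hγ i]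
  · have hP : samplePrice α S (Function.update v i b') = samplePrice α S v := by
      funext j
      unfold samplePrice
      rw [kthValue_congr (v' := v)]
      intro a ha
      exact Function.update_of_ne (ne_of_mem_of_not_mem ha hi) _ _
    have ht : taken α (samplePrice α S v) S (Function.update v i b') (Function.update γ i g') i
        = taken α (samplePrice α S v) S v γ i :=
      taken_congr _ _ _ _ (fun a ha => Function.update_of_ne (Fin.ne_of_lt ha) _ _)
        (fun a ha => Function.update_of_ne (Fin.ne_of_lt ha) _ _)
    have hbest' := isBest_bought α (samplePrice_last α S v) S (Function.update v i b')
      (Function.update γ i g') i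
    rw [ht] at hbest'
    simp only [sampleAssign, hP] at haff ⊢
    exact hbest.2.2 _ hbest'.1 haff

theorem ctr_nonneg {k : ℕ} {α : Fin k → ℝ} (hα : ∀ j, 0 ≤ α j) (j : Fin (k + 1)) :
    0 ≤ ctr k α j := by
  unfold ctr
  split_ifs
  · exact hα _
  · exact le_rfl

/-- Selling to `Sᶜ` at the prices from `S` recovers a quarter of the welfare of `S` on those slots
where the sample is dominated by its complement. -/
theorem sum_dominated_le {n k : ℕ} {α : Fin k → ℝ} (hα : ∀ j, 0 ≤ α j) (S : Finset (Fin n))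
    {v γ : Fin n → ℝ} (hv : ∀ i, 0 < v i) (hγ : ∀ i, 0 ≤ γ i) :
    ∑ j : Fin (k + 1), (if kthValue v S j ≤ kthValue v Sᶜ j then
      ctr k α j * kthValue v S j / 2 else 0) ≤ 2 * welfare n k α v (sampleAssign α S v γ) := by
  classical
  have hs := kthValue_nonneg hv S
  by_cases hT : Sᶜ.card = 0
  · have hw : 0 ≤ welfare n k α v (sampleAssign α S v γ) :=
      Finset.sum_nonneg fun i _ => mul_nonneg (hv i).le (ctr_nonneg hα _)
    refine le_trans (Finset.sum_nonpos fun j _ => ?_) (by linarith)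
    split_ifs with h
    · have h0 : kthValue v S j = 0 := by
        refine le_antisymm (h.trans_eq ?_) (hs _)
        simp [kthValue, hT]
      simp [h0]
    · exact le_rfl
  · let τ : Fin (k + 1) → Fin n := fun j =>
      if h : (j : ℕ) < Sᶜ.card then ranked v Sᶜ ⟨j, h⟩
      else ranked v Sᶜ ⟨0, Nat.pos_of_ne_zero hT⟩
    set J : Finset (Fin (k + 1)) := Finset.univ.filter fun j =>
      kthValue v S j ≤ kthValue v Sᶜ j ∧ (j : ℕ) < Sᶜ.card with hJ
    have hle : ∑ j ∈ J, samplePrice α S v j ≤ 2 * welfare n k α v (sampleAssign α S v γ) := by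
      refine sum_le_two_mul_welfare α (samplePrice_last α S v)
        (fun j => div_nonneg (mul_nonneg (ctr_nonneg hα j) (hs _)) (by norm_num)) S hγ J τ ?_ ?_ _
        (fun _ _ => le_rfl) ?_
      · intro a ha b hb hab
        simp only [hJ, Finset.coe_filter, Set.mem_ofPred_eq] at ha hb
        simp only [τ, ha.2.2, hb.2.2, dif_pos] at hab
        have := ranked_injective v Sᶜ hab
        simp only [Fin.mk.injEq] at this
        exact Fin.ext this
      · intro j hj
        simp only [hJ, Finset.mem_filter] at hj
        simp only [τ, hj.2.2, dif_pos]
        exact Finset.mem_compl.1 (ranked_mem v Sᶜ _)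
      · intro j hj
        simp only [hJ, Finset.mem_filter] at hj
        have hτ : v (τ j) = kthValue v Sᶜ j := by
          simp [τ, hj.2.2, kthValue]
        rw [hτ, samplePrice]
        nlinarith [mul_le_mul_of_nonneg_left hj.2.1 (ctr_nonneg hα j)]
    refine le_trans (le_of_eq ?_) hle
    rw [hJ, Finset.sum_filter]
    refine Finset.sum_congr rfl fun j _ => ?_
    by_cases h : kthValue v S j ≤ kthValue v Sᶜ j
    · by_cases hc : (j : ℕ) < Sᶜ.card
      · simp [h, hc, samplePrice]
      · have h0 : kthValue v S j = 0 := by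
          refine le_antisymm (h.trans_eq ?_) (hs _)
          simp [kthValue, hc]
        simp [h0, hc]
    · simp [h]

/-- A sample and its complement together recover the slotwise minimum of their order statistics. -/
theorem sum_min_le {n k : ℕ} {α : Fin k → ℝ} (hα : ∀ j, 0 ≤ α j) (S : Finset (Fin n))
    {v γ : Fin n → ℝ} (hv : ∀ i, 0 < v i) (hγ : ∀ i, 0 ≤ γ i) :
    ∑ j : Fin (k + 1), ctr k α j * min (kthValue v S j) (kthValue v Sᶜ j) ≤
      4 * (welfare n k α v (sampleAssign α S v γ) +
        welfare n k α v (sampleAssign α Sᶜ v γ)) := by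
  have h1 := sum_dominated_le hα S hv hγ
  have h2 := sum_dominated_le hα Sᶜ hv hγ
  rw [compl_compl] at h2
  have h3 : ∑ j : Fin (k + 1), ctr k α j * min (kthValue v S j) (kthValue v Sᶜ j) ≤
      ∑ j : Fin (k + 1), 2 * ((if kthValue v S j ≤ kthValue v Sᶜ j then
        ctr k α j * kthValue v S j / 2 else 0) + (if kthValue v Sᶜ j ≤ kthValue v S j then
        ctr k α j * kthValue v Sᶜ j / 2 else 0)) := by
    refine Finset.sum_le_sum fun j _ => ?_
    have hs := mul_nonneg (ctr_nonneg hα j) (kthValue_nonneg hv S j)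
    have ht := mul_nonneg (ctr_nonneg hα j) (kthValue_nonneg hv Sᶜ j)
    rcases le_total (kthValue v S j) (kthValue v Sᶜ j) with h | h
    · rw [min_eq_left h, if_pos h]
      split_ifs <;> linarith
    · rw [min_eq_right h, if_pos h]
      split_ifs <;> linarith
  rw [← Finset.mul_sum, Finset.sum_add_distrib] at h3
  linarith

/-! ### Split pairs -/

/-- Values in decreasing order, extended by `0`. -/
noncomputable def sortedValue {n : ℕ} (v : Fin n → ℝ) (σ : Equiv.Perm (Fin n)) (j : ℕ) : ℝ :=
  if h : j < n then v (σ ⟨j, h⟩) else 0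

/-- CTRs extended by `0`. -/
noncomputable def extCtr {k : ℕ} (α : Fin k → ℝ) (j : ℕ) : ℝ :=
  if h : j < k then α ⟨j, h⟩ else 0

/-- The sample separates the bidders ranked `2 * l` and `2 * l + 1`. -/
def Split {n : ℕ} (σ : Equiv.Perm (Fin n)) (S : Finset (Fin n)) (l : ℕ) : Prop :=
  ∃ h : 2 * l + 1 < n, ¬ (σ ⟨2 * l, by omega⟩ ∈ S ↔ σ ⟨2 * l + 1, h⟩ ∈ S)

theorem split_compl {n : ℕ} (σ : Equiv.Perm (Fin n)) (S : Finset (Fin n)) (l : ℕ) :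
    Split σ Sᶜ l ↔ Split σ S l := by
  simp only [Split, Finset.mem_compl, not_iff_not]

theorem extCtr_nonneg {k : ℕ} {α : Fin k → ℝ} (hα : ∀ j, 0 ≤ α j) (j : ℕ) : 0 ≤ extCtr α j := by
  unfold extCtr
  split_ifs
  · exact hα _
  · exact le_rfl

theorem extCtr_antitone {k : ℕ} {α : Fin k → ℝ} (hα : ∀ j, 0 ≤ α j)
    (hmono : ∀ j j' : Fin k, j ≤ j' → α j' ≤ α j) : Antitone (extCtr α) := by
  intro a b hab
  by_cases hb : b < k
  · rw [extCtr, extCtr, dif_pos hb, dif_pos (hab.trans_lt hb)]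
    exact hmono _ _ hab
  · rw [extCtr, dif_neg hb]
    exact extCtr_nonneg hα a

theorem sortedValue_nonneg {n : ℕ} {v : Fin n → ℝ} (hv : ∀ i, 0 < v i) (σ : Equiv.Perm (Fin n))
    (j : ℕ) : 0 ≤ sortedValue v σ j := by
  unfold sortedValue
  split_ifs
  · exact (hv _).le
  · exact le_rfl

theorem sortedValue_antitone {n : ℕ} {v : Fin n → ℝ} (hv : ∀ i, 0 < v i)
    {σ : Equiv.Perm (Fin n)} (hσ : Antitone (v ∘ σ)) : Antitone (sortedValue v σ) := by
  intro a b hab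
  by_cases hb : b < n
  · rw [sortedValue, sortedValue, dif_pos hb, dif_pos (hab.trans_lt hb)]
    exact hσ (show (⟨a, hab.trans_lt hb⟩ : Fin n) ≤ ⟨b, hb⟩ from hab)
  · rw [sortedValue, dif_neg hb]
    exact sortedValue_nonneg hv σ a

open Classical in
theorem sortedValue_le_kthValue {n : ℕ} {v : Fin n → ℝ}
    {σ : Equiv.Perm (Fin n)} (hσ : Antitone (v ∘ σ)) (S : Finset (Fin n)) {l : ℕ}
    (hl : Split σ S l) :
    sortedValue v σ (2 * l + 1) ≤
      kthValue v S ((Finset.range l).filter (Split σ S)).card := by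
  obtain ⟨hn, hsp⟩ := id hl
  have : NeZero n := ⟨by omega⟩
  refine le_kthValue v S ?_
  let pos : ℕ → ℕ := fun a =>
    if σ (Fin.ofNat n (2 * a)) ∈ S then 2 * a else 2 * a + 1
  let w : ℕ → Fin n := fun a => σ (Fin.ofNat n (pos a))
  have hof : ∀ a (h : a < n), Fin.ofNat n a = ⟨a, h⟩ := fun a h =>
    Fin.ext (by simp [Nat.mod_eq_of_lt h])
  have hpos : ∀ a, 2 * a ≤ pos a ∧ pos a ≤ 2 * a + 1 := by
    intro a
    simp only [pos]
    split_ifs <;> omega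
  have hcard : ((Finset.range (l + 1)).filter (Split σ S)).card
      = ((Finset.range l).filter (Split σ S)).card + 1 := by
    rw [Finset.range_add_one, Finset.filter_insert, if_pos hl, Finset.card_insert_of_notMem]
    simp
  rw [Nat.lt_iff_add_one_le, ← hcard]
  refine Finset.card_le_card_of_injOn w ?_ ?_
  · intro a ha
    simp only [Finset.coe_filter, Finset.mem_range, Set.mem_ofPred_eq] at ha ⊢
    obtain ⟨hal, han, hasp⟩ := ha
    have hp := hpos a
    have hpn : pos a < n := by omega
    refine ⟨?_, ?_⟩
    · simp only [w, pos]
      split_ifs with h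
      · exact h
      · rw [hof _ (by omega)] at h ⊢
        tauto
    · simp only [w]
      rw [hof _ hpn, sortedValue, dif_pos hn]
      exact hσ (show (⟨pos a, hpn⟩ : Fin n) ≤ ⟨2 * l + 1, hn⟩ from by
        rw [Fin.mk_le_mk]; omega)
  · intro a ha b hb hab
    simp only [Finset.coe_filter, Finset.mem_range, Set.mem_ofPred_eq] at ha hb
    have ha' := hpos a
    have hb' := hpos b
    have := σ.injective hab
    rw [hof (pos a) (by omega), hof (pos b) (by omega), Fin.mk.injEq] at this
    omega

open Classical in
theorem sum_split_le {n k : ℕ} {α : Fin k → ℝ} (hα : ∀ j, 0 ≤ α j)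
    (hmono : ∀ j j' : Fin k, j ≤ j' → α j' ≤ α j) {v : Fin n → ℝ} (hv : ∀ i, 0 < v i)
    {σ : Equiv.Perm (Fin n)} (hσ : Antitone (v ∘ σ)) (S : Finset (Fin n)) :
    ∑ l ∈ (Finset.range k).filter (Split σ S), extCtr α l * sortedValue v σ (2 * l + 1) ≤
      ∑ j : Fin (k + 1), ctr k α j * min (kthValue v S j) (kthValue v Sᶜ j) := by
  set r : ℕ → ℕ := fun l => ((Finset.range l).filter (Split σ S)).card with hr
  have hrl : ∀ l, r l ≤ l := fun l =>
    (Finset.card_filter_le _ _).trans_eq (Finset.card_range l)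
  set m : ℕ → ℝ := fun j => min (kthValue v S j) (kthValue v Sᶜ j) with hm
  have hm0 : ∀ j, 0 ≤ m j := fun j => le_min (kthValue_nonneg hv _ _) (kthValue_nonneg hv _ _)
  have hlt : ∀ a b, Split σ S a → a < b → r a < r b := by
    intro a b ha hab
    refine Finset.card_lt_card ((Finset.ssubset_iff_of_subset ?_).2 ⟨a, ?_, ?_⟩)
    · exact Finset.filter_subset_filter _ (Finset.range_mono hab.le)
    · simp [ha, hab]
    · simp
  have hinj : Set.InjOn r ((Finset.range k).filter (Split σ S)) := by
    intro a ha b hb hab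
    simp only [Finset.coe_filter, Set.mem_ofPred_eq] at ha hb
    rcases lt_trichotomy a b with h | h | h
    · exact absurd hab (hlt a b ha.2 h).ne
    · exact h
    · exact absurd hab (hlt b a hb.2 h).ne'
  have hrhs : ∑ j : Fin (k + 1), ctr k α j * min (kthValue v S j) (kthValue v Sᶜ j)
      = ∑ j ∈ Finset.range (k + 1), extCtr α j * m j := by
    rw [Finset.sum_range]
    rfl
  rw [hrhs]
  calc ∑ l ∈ (Finset.range k).filter (Split σ S), extCtr α l * sortedValue v σ (2 * l + 1)
      ≤ ∑ l ∈ (Finset.range k).filter (Split σ S), extCtr α (r l) * m (r l) := by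
        refine Finset.sum_le_sum fun l hl => ?_
        rw [Finset.mem_filter] at hl
        refine mul_le_mul (extCtr_antitone hα hmono (hrl l)) (le_min ?_ ?_)
          (sortedValue_nonneg hv _ _) (extCtr_nonneg hα _)
        · exact sortedValue_le_kthValue hσ S hl.2
        · have h := sortedValue_le_kthValue hσ Sᶜ ((split_compl σ S l).2 hl.2)
          simp only [split_compl] at h
          exact h
    _ = ∑ j ∈ ((Finset.range k).filter (Split σ S)).image r, extCtr α j * m j :=
        (Finset.sum_image (f := fun j => extCtr α j * m j) hinj).symm
    _ ≤ ∑ j ∈ Finset.range (k + 1), extCtr α j * m j := by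
        refine Finset.sum_le_sum_of_subset_of_nonneg ?_
          fun j _ _ => mul_nonneg (extCtr_nonneg hα j) (hm0 j)
        intro j hj
        obtain ⟨l, hl, rfl⟩ := Finset.mem_image.1 hj
        rw [Finset.mem_filter, Finset.mem_range] at hl
        exact Finset.mem_range.2 (by have := hrl l; omega)

open Classical in
/-- A given pair is split by exactly half of all samples. -/
theorem two_mul_card_split {n : ℕ} (σ : Equiv.Perm (Fin n)) {l : ℕ} (hl : 2 * l + 1 < n) :
    2 * ((Finset.univ : Finset (Finset (Fin n))).filter fun S => Split σ S l).card = 2 ^ n := by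
  set b : Fin n := σ ⟨2 * l + 1, hl⟩ with hb
  have hne : σ ⟨2 * l, by omega⟩ ≠ b := by
    intro h
    have := σ.injective h
    simp at this
  have htog : ∀ S : Finset (Fin n), Split σ (symmDiff S {b}) l ↔ ¬ Split σ S l := by
    intro S
    simp only [Split, hl, exists_true_left, Finset.mem_symmDiff, Finset.mem_singleton, ← hb, hne]
    tauto
  have hinv : Function.Involutive fun S : Finset (Fin n) => symmDiff S {b} := fun S => by
    simp
  have hcard : ((Finset.univ : Finset (Finset (Fin n))).filter fun S => Split σ S l).card =
      ((Finset.univ : Finset (Finset (Fin n))).filter fun S => ¬ Split σ S l).card := by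
    refine Finset.card_bij (fun S _ => symmDiff S {b}) ?_ ?_ ?_
    · intro S hS
      simp only [Finset.mem_filter, Finset.mem_univ, true_and] at hS ⊢
      rw [htog]
      exact not_not.2 hS
    · intro S _ T _ h
      exact hinv.injective h
    · intro S hS
      simp only [Finset.mem_filter, Finset.mem_univ, true_and] at hS
      exact ⟨symmDiff S {b}, by simpa [htog] using hS, hinv S⟩
  have htot := Finset.card_filter_add_card_filter_not (s := (Finset.univ : Finset (Finset (Fin n))))
    (fun S => Split σ S l)
  rw [← hcard, Finset.card_univ, Fintype.card_finset, Fintype.card_fin] at htot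
  omega

theorem sum_welfare_ge {n k : ℕ} {α : Fin k → ℝ} (hα : ∀ j, 0 ≤ α j)
    (hmono : ∀ j j' : Fin k, j ≤ j' → α j' ≤ α j) {v γ : Fin n → ℝ} (hv : ∀ i, 0 < v i)
    (hγ : ∀ i, 0 ≤ γ i) {σ : Equiv.Perm (Fin n)} (hσ : Antitone (v ∘ σ)) :
    2 ^ n * ∑ l ∈ Finset.range k, extCtr α l * sortedValue v σ (2 * l + 1) ≤
      16 * ∑ S : Finset (Fin n), welfare n k α v (sampleAssign α S v γ) := by
  classical
  set W : Finset (Fin n) → ℝ := fun S => welfare n k α v (sampleAssign α S v γ) with hW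
  set z : ℕ → ℝ := fun l => extCtr α l * sortedValue v σ (2 * l + 1) with hz
  have h1 : ∑ S : Finset (Fin n), ∑ l ∈ (Finset.range k).filter (Split σ S), z l ≤
      ∑ S : Finset (Fin n), 4 * (W S + W Sᶜ) :=
    Finset.sum_le_sum fun S _ => (sum_split_le hα hmono hv hσ S).trans (sum_min_le hα S hv hγ)
  have h2 : ∑ S : Finset (Fin n), W Sᶜ = ∑ S, W S :=
    Equiv.sum_comp (compl_involutive (α := Finset (Fin n))).toPerm W
  rw [← Finset.mul_sum, Finset.sum_add_distrib, h2] at h1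
  have h3 : 2 * ∑ S : Finset (Fin n), ∑ l ∈ (Finset.range k).filter (Split σ S), z l
      = 2 ^ n * ∑ l ∈ Finset.range k, z l := by
    simp only [Finset.sum_filter]
    rw [Finset.sum_comm, Finset.mul_sum, Finset.mul_sum]
    refine Finset.sum_congr rfl fun l _ => ?_
    by_cases hl : 2 * l + 1 < n
    · rw [← Finset.sum_filter, Finset.sum_const, nsmul_eq_mul, ← mul_assoc]
      congr 1
      exact_mod_cast two_mul_card_split σ hl
    · have : z l = 0 := by simp [hz, sortedValue, hl]
      simp [this]
  linarith

/-! ### Bounding the optimum -/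

theorem welfare_le_sum_sorted {n k : ℕ} (hkn : k ≤ n) {α : Fin k → ℝ} (hα : ∀ j, 0 ≤ α j)
    (hmono : ∀ j j' : Fin k, j ≤ j' → α j' ≤ α j) {v : Fin n → ℝ} (hv : ∀ i, 0 < v i)
    {σ : Equiv.Perm (Fin n)} (hσ : Antitone (v ∘ σ)) {π : Fin n → Fin (k + 1)}
    (hπ : Feasible n k π) :
    welfare n k α v π ≤ ∑ j ∈ Finset.range n, extCtr α j * sortedValue v σ j := by
  classical
  rcases Nat.eq_zero_or_pos n with rfl | hn
  · simp [welfare]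
  have : NeZero n := ⟨hn.ne'⟩
  set s : Finset (Fin n) := Finset.univ.filter fun i => (π i : ℕ) < k with hs
  obtain ⟨ψ, hψ⟩ := Finset.exists_equiv_extend_of_card_eq (α := Fin n) (t := Finset.univ)
    (by simp) (s := s) (f := fun i => Fin.ofNat n (π i)) (by simp) (by
      intro a ha b hb hab
      simp only [hs, Finset.coe_filter, Set.mem_ofPred_eq, Finset.mem_univ, true_and] at ha hb
      have := congrArg Fin.val hab
      simp only [Fin.ofNat, Nat.mod_eq_of_lt (ha.trans_le hkn),
        Nat.mod_eq_of_lt (hb.trans_le hkn)] at this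
      exact hπ a b (Fin.ext this) ha)
  let e : Equiv.Perm (Fin n) := ψ.trans (Equiv.subtypeUnivEquiv fun x => Finset.mem_univ x)
  have hle : ∀ i, ctr k α (π i) ≤ extCtr α (e i : Fin n) := by
    intro i
    by_cases hi : (π i : ℕ) < k
    · have h : e i = Fin.ofNat n (π i) := hψ i (by simp [hs, hi])
      rw [h]
      simp only [Fin.ofNat, Nat.mod_eq_of_lt (hi.trans_le hkn)]
      exact le_rfl
    · rw [ctr, dif_neg hi]
      exact extCtr_nonneg hα _
  have hvary : Monovary (fun i : Fin n => extCtr α i) (v ∘ σ) := by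
    refine Antitone.monovary (fun a b hab => extCtr_antitone hα hmono hab) hσ
  calc welfare n k α v π ≤ ∑ i, v i * extCtr α (e i : Fin n) :=
        Finset.sum_le_sum fun i _ => mul_le_mul_of_nonneg_left (hle i) (hv i).le
    _ = ∑ i, extCtr α ((σ.trans e) i : Fin n) * (v ∘ σ) i := by
        rw [← Equiv.sum_comp σ]
        exact Finset.sum_congr rfl fun i _ => mul_comm _ _
    _ ≤ ∑ i : Fin n, extCtr α i * (v ∘ σ) i := hvary.sum_comp_perm_mul_le_sum_mul
    _ = ∑ j ∈ Finset.range n, extCtr α j * sortedValue v σ j := by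
        rw [Finset.sum_range]
        exact Finset.sum_congr rfl fun i _ => by simp [sortedValue]

theorem OPT_le_sum_sorted {n k : ℕ} (hkn : k ≤ n) {α : Fin k → ℝ} (hα : ∀ j, 0 ≤ α j)
    (hmono : ∀ j j' : Fin k, j ≤ j' → α j' ≤ α j) {v : Fin n → ℝ} (hv : ∀ i, 0 < v i)
    {σ : Equiv.Perm (Fin n)} (hσ : Antitone (v ∘ σ)) :
    OPT n k α v ≤ ∑ j ∈ Finset.range n, extCtr α j * sortedValue v σ j := by
  refine csSup_le ⟨_, fun _ => Fin.last k, ?_, rfl⟩ ?_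
  · intro i j _ h
    simp at h
  · rintro w ⟨π, hπ, rfl⟩
    exact welfare_le_sum_sorted hkn hα hmono hv hσ hπ

theorem sum_range_le_pairs {a u : ℕ → ℝ} (ha : Antitone a) (hu : Antitone u) (ha0 : ∀ j, 0 ≤ a j)
    (hu0 : ∀ j, 0 ≤ u j) (m : ℕ) :
    ∑ j ∈ Finset.range (2 * m + 1), a j * u j ≤
      a 0 * u 0 + 2 * ∑ l ∈ Finset.range m, a l * u (2 * l + 1) := by
  induction m with
  | zero => simp
  | succ m ih =>
    rw [show 2 * (m + 1) + 1 = 2 * m + 1 + 1 + 1 by ring, Finset.sum_range_succ,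
      Finset.sum_range_succ, Finset.sum_range_succ (fun l => a l * u (2 * l + 1))]
    have h1 : a (2 * m + 1) * u (2 * m + 1) ≤ a m * u (2 * m + 1) :=
      mul_le_mul_of_nonneg_right (ha (by omega)) (hu0 _)
    have h2 : a (2 * m + 1 + 1) * u (2 * m + 1 + 1) ≤ a m * u (2 * m + 1) :=
      mul_le_mul (ha (by omega)) (hu (by omega)) (hu0 _) (ha0 _)
    linarith

theorem OPT_le_pairs {n k : ℕ} (hkn : k ≤ n) {α : Fin k → ℝ} (hα : ∀ j, 0 ≤ α j)
    (hmono : ∀ j j' : Fin k, j ≤ j' → α j' ≤ α j) {v : Fin n → ℝ} (hv : ∀ i, 0 < v i)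
    {σ : Equiv.Perm (Fin n)} (hσ : Antitone (v ∘ σ)) :
    OPT n k α v ≤ extCtr α 0 * sortedValue v σ 0 +
      2 * ∑ l ∈ Finset.range k, extCtr α l * sortedValue v σ (2 * l + 1) := by
  refine (OPT_le_sum_sorted hkn hα hmono hv hσ).trans ?_
  refine le_trans ?_ (sum_range_le_pairs (extCtr_antitone hα hmono) (sortedValue_antitone hv hσ)
    (extCtr_nonneg hα) (sortedValue_nonneg hv σ) k)
  have hterm : ∀ j, 0 ≤ extCtr α j * sortedValue v σ j := fun j =>
    mul_nonneg (extCtr_nonneg hα j) (sortedValue_nonneg hv σ j)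
  have hzero : ∀ j, k ≤ j → extCtr α j * sortedValue v σ j = 0 := fun j hj => by
    simp [extCtr, hj.not_gt]
  calc ∑ j ∈ Finset.range n, extCtr α j * sortedValue v σ j
      = ∑ j ∈ Finset.range k, extCtr α j * sortedValue v σ j := by
        refine (Finset.sum_subset (Finset.range_mono hkn) fun j _ hj => hzero j ?_).symm
        simpa using hj
    _ ≤ ∑ j ∈ Finset.range (2 * k + 1), extCtr α j * sortedValue v σ j :=
        Finset.sum_le_sum_of_subset_of_nonneg (Finset.range_mono (by omega)) fun j _ _ => hterm j

/-- Theorem 4: there is a universally truthful randomized mechanism whose expected welfare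
at the truthful report is at least `(1 - 1/ρ)/48 · OPT` on every profile satisfying the
large-market assumption `vᵢ·α₁ < OPT/ρ` for all `i`. -/
theorem large_market_auction (n k : ℕ) (hk : 1 ≤ k) (hkn : k ≤ n)
    (α : Fin k → ℝ) (hα : ∀ j, 0 ≤ α j)
    (hmono : ∀ j j' : Fin k, j ≤ j' → α j' ≤ α j)
    (ρ : ℝ) (hρ : 1 < ρ) :
    ∃ (m : ℕ) (μ : Fin m → ℝ)
      (asg : Fin m → (Fin n → ℝ) → (Fin n → ℝ) → Fin n → Fin (k + 1))
      (pay : Fin m → (Fin n → ℝ) → (Fin n → ℝ) → Fin n → ℝ),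
      (∀ ω, 0 ≤ μ ω) ∧ (∑ ω, μ ω) = 1 ∧
      (∀ ω b g, Feasible n k (asg ω b g)) ∧
      (∀ ω, TruthfulPriv n k α (asg ω) (pay ω)) ∧
      ∀ v γ : Fin n → ℝ, (∀ i, 0 < v i) → (∀ i, 0 ≤ γ i) →
        (∀ i, v i * α ⟨0, hk⟩ < OPT n k α v / ρ) →
        (∑ ω, μ ω * welfare n k α v (asg ω v γ)) ≥ (1 - 1 / ρ) / 48 * OPT n k α v := by
  classical
  let e : Finset (Fin n) ≃ Fin (Fintype.card (Finset (Fin n))) := Fintype.equivFin _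
  refine ⟨Fintype.card (Finset (Fin n)), fun _ => 1 / 2 ^ n,
    fun ω => sampleAssign α (e.symm ω),
    fun ω v γ i => samplePrice α (e.symm ω) v (sampleAssign α (e.symm ω) v γ i),
    fun _ => by positivity, by simp, fun ω b g => feasible_bought α (samplePrice_last _ _ _) _ _ _,
    fun ω => truthfulPriv_sampleAssign α _, ?_⟩
  intro v γ hv hγ hlarge
  have hn : 0 < n := by omega
  obtain ⟨σ, hσ⟩ : ∃ σ : Equiv.Perm (Fin n), Antitone (v ∘ σ) := by
    refine ⟨Tuple.sort (fun i => -v i), fun a b hab => ?_⟩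
    have := Tuple.monotone_sort (fun i => -v i) hab
    simpa using this
  have hsum : ∑ ω, 1 / 2 ^ n * welfare n k α v (sampleAssign α (e.symm ω) v γ)
      = 1 / 2 ^ n * ∑ S : Finset (Fin n), welfare n k α v (sampleAssign α S v γ) := by
    rw [← Finset.mul_sum]
    congr 1
    exact Equiv.sum_comp e.symm fun S => welfare n k α v (sampleAssign α S v γ)
  rw [hsum]
  have hW := sum_welfare_ge hα hmono hv hγ hσ
  have hO := OPT_le_pairs hkn hα hmono hv hσ
  have htop : extCtr α 0 * sortedValue v σ 0 < OPT n k α v / ρ := by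
    have := hlarge (σ ⟨0, hn⟩)
    rw [extCtr, sortedValue, dif_pos (show 0 < k from hk), dif_pos hn, mul_comm]
    exact this
  set Q := ∑ l ∈ Finset.range k, extCtr α l * sortedValue v σ (2 * l + 1)
  set R := ∑ S : Finset (Fin n), welfare n k α v (sampleAssign α S v γ)
  have hQ : 0 ≤ Q := Finset.sum_nonneg fun l _ =>
    mul_nonneg (extCtr_nonneg hα l) (sortedValue_nonneg hv σ _)
  have hpow : (0 : ℝ) < 2 ^ n := by positivity
  have hR : Q / 16 ≤ 1 / 2 ^ n * R := by
    rw [one_div, inv_mul_eq_div, le_div_iff₀ hpow]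
    linarith
  have hgap : (1 - 1 / ρ) * OPT n k α v ≤ 2 * Q := by
    have : (1 - 1 / ρ) * OPT n k α v = OPT n k α v - OPT n k α v / ρ := by ring
    linarith
  rw [ge_iff_le, div_mul_eq_mul_div]
  linarith
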